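/- Let $A$ be an additive commutative group, let $f : \mathbb{N} \to A$ be any function, and let $d \geq 2$ be an integer. Consider the signed sum $S = \sum_{\mathbf{d}} (-1)^{r(\mathbf{d})} f(d_0(\mathbf{d}))$, where $\mathbf{d}$ ranges over all stable sequences of degrees $(d_0, d_1, \dots, d_r)$ with $d_0 + d_1 + \cdots + d_r = d$, $r(\mathbf{d}) = r$ denotes one less than the length of the sequence, and $d_0(\mathbf{d}) = d_0$ denotes its first entry. Then $S = f(d) - f(d-1)$. In particular, if $f(d) = f(d-1)$ then $S = 0$. -/

import Mathlib

/-- The stable sequences of degrees `(d₀, d₁, …, d_r)` with total degree `d`: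
nonempty lists of nonnegative integers whose entries after the first are all
positive and whose sum is `d`. -/
def stableSequences (d : ℕ) : Set (List ℕ) :=
  {l | l ≠ [] ∧ (∀ x ∈ l.tail, 1 ≤ x) ∧ l.sum = d}

theorem stableSequences_finite (d : ℕ) : (stableSequences d).Finite := by
  refine (Set.finite_range fun c : Composition (d + 1) => c.blocks.modifyHead Nat.pred).subset ?_
  rintro (_ | ⟨a, t⟩) ⟨hne, hpos, hsum⟩
  · exact absurd rfl hne
  · simp only [List.tail_cons, List.sum_cons] at hpos hsum
    refine ⟨⟨(a + 1) :: t, ?_, ?_⟩, by simp⟩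
    · intro x hx
      rcases List.mem_cons.1 hx with rfl | hx
      · omega
      · exact hpos x hx
    · simp only [List.sum_cons]
      omega

/-- Splits a second entry `b + 2` into `1, b + 1`, and merges a second entry `1` with the entry
following it. This reverses the sign of every sequence it does not fix. -/
def splitOrMerge : List ℕ → List ℕ
  | a :: (b + 2) :: t => a :: 1 :: (b + 1) :: t
  | a :: 1 :: c :: t => a :: (c + 1) :: t
  | l => l

/-- A stable sequence is `[d]`, `[d - 1, 1]`, or one that `splitOrMerge` moves. -/
theorem stableSequences_cases {d : ℕ} {l : List ℕ} (hl : l ∈ stableSequences d) :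
    l = [d] ∨ l = [d - 1, 1] ∨ (∃ a b t, l = a :: (b + 2) :: t) ∨
      ∃ a c t, l = a :: 1 :: (c + 1) :: t := by
  obtain ⟨hne, hpos, hsum⟩ := hl
  match l with
  | [] => exact absurd rfl hne
  | [a] => left; simpa using hsum
  | a :: 0 :: t => simp at hpos
  | a :: (b + 2) :: t => exact .inr (.inr (.inl ⟨a, b, t, rfl⟩))
  | [a, 1] =>
    right; left
    simp only [List.sum_cons, List.sum_nil] at hsum
    simp only [List.cons.injEq, and_true]
    omega
  | a :: 1 :: 0 :: t => simp at hpos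
  | a :: 1 :: (c + 1) :: t => exact .inr (.inr (.inr ⟨a, c, t, rfl⟩))

theorem sum_stableSequences {A : Type*} [AddCommGroup A] (f : ℕ → A) (d : ℕ) (hd : 1 ≤ d) :
    (∑ᶠ l ∈ stableSequences d, ((-1 : ℤ) ^ (l.length - 1)) • f l.headI) = f d - f (d - 1) := by
  classical
  have hsub : ({[d], [d - 1, 1]} : Finset (List ℕ)) ⊆ (stableSequences_finite d).toFinset := by
    intro l hl
    rw [Set.Finite.mem_toFinset]
    rcases Finset.mem_insert.1 hl with rfl | hl
    · simp [stableSequences]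
    · rw [Finset.mem_singleton.1 hl]
      simp only [stableSequences, Set.mem_ofPred_eq]
      refine ⟨by simp, by simp, ?_⟩
      simp only [List.sum_cons, List.sum_nil]
      omega
  have hmoved : ∀ l ∈ (stableSequences_finite d).toFinset \ {[d], [d - 1, 1]},
      (∃ a b t, l = a :: (b + 2) :: t) ∨ ∃ a c t, l = a :: 1 :: (c + 1) :: t := by
    intro l hl
    simp only [Finset.mem_sdiff, Set.Finite.mem_toFinset, Finset.mem_insert,
      Finset.mem_singleton, not_or] at hl
    exact ((stableSequences_cases hl.1).resolve_left hl.2.1).resolve_left hl.2.2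
  have hcancel : ∑ l ∈ (stableSequences_finite d).toFinset \ {[d], [d - 1, 1]},
      ((-1 : ℤ) ^ (l.length - 1)) • f l.headI = 0 := by
    refine Finset.sum_involution (fun l _ => splitOrMerge l) ?_ ?_ ?_ ?_
    · intro l hl
      rcases hmoved l hl with ⟨a, b, t, rfl⟩ | ⟨a, c, t, rfl⟩ <;>
        simp [splitOrMerge, pow_succ]
    · intro l hl _
      rcases hmoved l hl with ⟨a, b, t, rfl⟩ | ⟨a, c, t, rfl⟩ <;>
        simp [splitOrMerge]
    · intro l hl
      rcases hmoved l hl with ⟨a, b, t, rfl⟩ | ⟨a, c, t, rfl⟩ <;>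
        simp [splitOrMerge, stableSequences] at hl ⊢ <;> grind
    · intro l hl
      rcases hmoved l hl with ⟨a, b, t, rfl⟩ | ⟨a, c, t, rfl⟩ <;>
        simp [splitOrMerge]
  rw [finsum_mem_eq_finite_toFinset_sum _ (stableSequences_finite d), ← Finset.sum_sdiff hsub,
    hcancel, zero_add, Finset.sum_pair (by simp)]
  simp [sub_eq_add_neg]

/-- For any function `f : ℕ → A` into an additive commutative group and any `d ≥ 2`,
the signed sum `∑ (-1)^(r(𝐝)) • f(d₀(𝐝))` over all stable sequences of degrees `𝐝`
with total degree `d` equals `f d - f (d-1)`; in particular it vanishes when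
`f d = f (d-1)`. -/
theorem signed_sum_over_stable_sequences {A : Type*} [AddCommGroup A]
    (f : ℕ → A) (d : ℕ) (hd : 2 ≤ d) :
    (∑ᶠ l ∈ stableSequences d, ((-1 : ℤ) ^ (l.length - 1)) • f l.headI)
      = f d - f (d - 1) ∧
    (f d = f (d - 1) →
      (∑ᶠ l ∈ stableSequences d, ((-1 : ℤ) ^ (l.length - 1)) • f l.headI) = 0) := by
  have hsum := sum_stableSequences f d (by omega)
  exact ⟨hsum, fun h => by rw [hsum, h, sub_self]⟩
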